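/- Let P ⊂ ℝ³ be a polytope with vertices x₁,…,x_V and suppose for each t in an interval [−c, c] the polytope P_t = conv{x_i + t α_i θ} has the same face lattice as P (with the correspondence x_i ↦ x_i(t) on vertices and facet vertex-sets preserved). Then t ↦ vol(P_t) is an affine function on [−c, c]. -/

import Mathlib

open Set MeasureTheory Topology

/-- An extreme convex subset of `P` that meets the relative interior of the chord cut out of `P` by
a line whose projection along `θ` is interior to the projection of `P` is all of `P`. -/
theorem IsExtreme.subset_of_mem_openSegment_line {E : Type*} [AddCommGroup E] [Module ℝ E]
    {P F : Set E} (hP : Convex ℝ P) (hF : IsExtreme ℝ P F) (hFc : Convex ℝ F) {z θ : E}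
    (hz : ∀ p ∈ P, ∃ ε > (0 : ℝ), ∃ s : ℝ, z + ε • (z - p) + s • θ ∈ P) {u v s : ℝ}
    (hD : ∀ r : ℝ, z + r • θ ∈ P ↔ r ∈ Icc u v) (hs : s ∈ openSegment ℝ u v)
    (hq : z + s • θ ∈ F) : P ⊆ F := by
  intro p hp
  obtain ⟨ε, hε, r, hr⟩ := hz p hp
  have huv : u ≤ v := ((hD s).1 (hF.subset hq)).1.trans ((hD s).1 (hF.subset hq)).2
  have hu : z + u • θ ∈ P := (hD u).2 ⟨le_rfl, huv⟩
  have hv : z + v • θ ∈ P := (hD v).2 ⟨huv, le_rfl⟩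
  have line : ∀ a b : ℝ, a + b = 1 → a • (z + u • θ) + b • (z + v • θ) =
      z + (a • u + b • v) • θ := by
    intro a b hab
    obtain rfl : b = 1 - a := by linarith
    simp only [smul_eq_mul]
    module
  obtain ⟨a, b, ha, hb, hab, rfl⟩ := hs
  rw [← line a b hab] at hq
  have hseg : a • (z + u • θ) + b • (z + v • θ) ∈ openSegment ℝ (z + u • θ) (z + v • θ) :=
    ⟨a, b, ha, hb, hab, rfl⟩
  have huF := hF.left_mem_of_mem_openSegment hu hv hq hseg
  have hvF := hF.left_mem_of_mem_openSegment hv hu hq (by rwa [openSegment_symm])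
  have h1 : (0 : ℝ) < 1 + ε := by linarith
  have hcomb : (ε / (1 + ε)) • p + (1 / (1 + ε)) • (z + ε • (z - p) + r • θ) =
      z + (r / (1 + ε)) • θ := by
    match_scalars <;> field_simp
    ring
  have hsum : ε / (1 + ε) + 1 / (1 + ε) = 1 := by field_simp; ring
  have hmem : z + (r / (1 + ε)) • θ ∈ P := by
    rw [← hcomb]
    exact hP hp hr (by positivity) (by positivity) hsum
  have hmemF : z + (r / (1 + ε)) • θ ∈ F := by
    have := (hD _).1 hmem
    rw [← segment_eq_Icc huv] at this
    obtain ⟨a', b', ha', hb', hab', h⟩ := this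
    rw [← h, ← line a' b' hab']
    exact hFc huF hvF ha' hb' hab'
  exact hF.left_mem_of_mem_openSegment hp hr hmemF
    ⟨_, _, by positivity, by positivity, hsum, hcomb⟩

theorem convexHull_image_setOf_eq {E ι : Type*} [AddCommGroup E] [Module ℝ E] (x : ι → E)
    (f : E →ₗ[ℝ] ℝ) {m : ℝ} (hf : ∀ i, f (x i) ≤ m) :
    convexHull ℝ (x '' {i | f (x i) = m}) = {q ∈ convexHull ℝ (range x) | f q = m} := by
  set F := convexHull ℝ (x '' {i | f (x i) = m}) with hFdef
  have hFm : ∀ q ∈ F, f q = m := by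
    have : F ⊆ {q | f q = m} := by
      refine convexHull_min ?_ (convex_hyperplane f.isLinear m)
      rintro _ ⟨i, hi, rfl⟩
      exact hi
    exact this
  have hlt : convexHull ℝ (range x) ⊆ {q | f q < m ∨ q ∈ F} := by
    refine convexHull_min ?_ ?_
    · rintro _ ⟨i, rfl⟩
      rcases (hf i).lt_or_eq with h | h
      · exact Or.inl h
      · exact Or.inr (subset_convexHull ℝ _ ⟨i, h, rfl⟩)
    · rw [convex_iff_openSegment_subset]
      rintro p hp q hq _ ⟨a, b, ha, hb, hab, rfl⟩
      have hm : m = a * m + b * m := by rw [← add_mul, hab, one_mul]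
      rcases hp with hp | hp <;> rcases hq with hq | hq
      · left
        simp only [map_add, map_smul, smul_eq_mul]
        nlinarith
      · left
        simp only [map_add, map_smul, smul_eq_mul]
        have := hFm q hq
        nlinarith
      · left
        simp only [map_add, map_smul, smul_eq_mul]
        have := hFm p hp
        nlinarith
      · exact Or.inr (convex_convexHull ℝ _ hp hq ha.le hb.le hab)
  ext q
  constructor
  · exact fun hq => ⟨convexHull_mono (image_subset_range _ _) hq, hFm q hq⟩
  · rintro ⟨hq, hqm⟩
    exact (hlt hq).resolve_left (by linarith)

/-- A boundary point of a full-dimensional polytope lies in a face spanned by some of the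
vertices only. -/
theorem exists_isExtreme_convexHull_image_of_notMem_interior {E ι : Type*} [AddCommGroup E]
    [Module ℝ E] [TopologicalSpace E] [IsTopologicalAddGroup E] [ContinuousSMul ℝ E]
    (x : ι → E) (hint : (interior (convexHull ℝ (range x))).Nonempty) {p : E}
    (hp : p ∈ convexHull ℝ (range x)) (hp' : p ∉ interior (convexHull ℝ (range x))) :
    ∃ S : Set ι, S ≠ univ ∧ IsExtreme ℝ (convexHull ℝ (range x)) (convexHull ℝ (x '' S)) ∧
      p ∈ convexHull ℝ (x '' S) := by
  have hconv := convex_convexHull ℝ (range x)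
  obtain ⟨f, hf⟩ := geometric_hahn_banach_open_point hconv.interior isOpen_interior hp'
  have hle : ∀ q ∈ convexHull ℝ (range x), f q ≤ f p := by
    intro q hq
    have h1 := (Convex.closure_interior_eq_closure_of_nonempty_interior hconv hint).ge
      (subset_closure hq)
    exact closure_minimal (t := {q | f q ≤ f p}) (fun a ha => (hf a ha).le)
      (isClosed_le f.continuous continuous_const) h1
  have heq := convexHull_image_setOf_eq x f.toLinearMap (m := f p)
    fun i => hle _ (subset_convexHull ℝ _ ⟨i, rfl⟩)
  refine ⟨{i | f (x i) = f p}, ?_, ?_, ?_⟩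
  · intro h
    obtain ⟨a, ha⟩ := hint
    have h2 := (heq ▸ (show a ∈ convexHull ℝ (x '' {i | f.toLinearMap (x i) = f p}) by
      have h3 : {i | f.toLinearMap (x i) = f p} = univ := h
      rw [h3, image_univ]; exact interior_subset ha) :
        a ∈ {q ∈ convexHull ℝ (range x) | f.toLinearMap q = f p}).2
    exact (hf a ha).ne h2
  · refine IsExposed.isExtreme (fun _ => ⟨f, heq.trans ?_⟩)
    ext q
    exact ⟨fun h => ⟨h.1, fun y hy => (hle y hy).trans h.2.ge⟩,
      fun h => ⟨h.1, le_antisymm (hle q h.1) (h.2 p hp)⟩⟩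
  · exact heq.ge ⟨hp, rfl⟩

theorem exists_line_mem_iff_mem_Icc {E : Type*} [AddCommGroup E] [Module ℝ E]
    [TopologicalSpace E] [IsTopologicalAddGroup E] [ContinuousSMul ℝ E] [T2Space E] {P : Set E}
    (hP : Convex ℝ P) (hPc : IsCompact P) {z θ : E} (hθ : θ ≠ 0)
    (hne : ∃ r : ℝ, z + r • θ ∈ P) :
    ∃ u v : ℝ, u ≤ v ∧ ∀ r : ℝ, z + r • θ ∈ P ↔ r ∈ Icc u v := by
  have hemb : Topology.IsClosedEmbedding fun r : ℝ => z + r • θ :=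
    (Homeomorph.addLeft z).isClosedEmbedding.comp (isClosedEmbedding_smul_left hθ)
  have hcomp := hemb.isCompact_preimage hPc
  have hconv : Convex ℝ ((fun r : ℝ => z + r • θ) ⁻¹' P) := by
    intro r hr s hs a b ha hb hab
    have : z + (a • r + b • s) • θ = a • (z + r • θ) + b • (z + s • θ) := by
      obtain rfl : b = 1 - a := by linarith
      simp only [smul_eq_mul]
      module
    rw [mem_preimage, this]
    exact hP hr hs ha hb hab
  have heq := eq_Icc_of_connected_compact ⟨hne, hconv.isPreconnected⟩ hcomp
  refine ⟨_, _, ?_, fun r => Set.ext_iff.1 heq r⟩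
  rw [← nonempty_Icc, ← heq]
  exact hne

/-- The vertices at time `t` of the shadow system with speeds `α` in direction `θ`. -/
def shadowVertex {E ι : Type*} [AddCommGroup E] [Module ℝ E] (x : ι → E) (α : ι → ℝ) (θ : E)
    (t : ℝ) (i : ι) : E := x i + t • α i • θ

theorem mem_convexHull_shadowVertex_image {E ι : Type*} [AddCommGroup E] [Module ℝ E]
    (x : ι → E) (α : ι → ℝ) (θ : E) (t : ℝ) (S : Set ι) (p : E) :
    p ∈ convexHull ℝ (shadowVertex x α θ t '' S) ↔
      ∃ a : ℝ, (p - (t * a) • θ, a) ∈ convexHull ℝ ((fun i => (x i, α i)) '' S) := by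
  let T : E × ℝ →ₗ[ℝ] E :=
    LinearMap.fst ℝ E ℝ + t • (LinearMap.snd ℝ E ℝ).smulRight θ
  have hT : ∀ q : E × ℝ, T q = q.1 + t • q.2 • θ := fun q => rfl
  have himg : shadowVertex x α θ t '' S = T '' ((fun i => (x i, α i)) '' S) := by
    rw [image_image]; rfl
  rw [himg, ← LinearMap.image_convexHull]
  constructor
  · rintro ⟨⟨e, a⟩, h, rfl⟩
    refine ⟨a, ?_⟩
    rwa [hT, smul_smul, add_sub_cancel_right]
  · rintro ⟨a, h⟩
    exact ⟨_, h, by simp [hT, smul_smul]⟩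

theorem exists_shift_mem_convexHull_shadowVertex {E ι : Type*} [AddCommGroup E] [Module ℝ E]
    (x : ι → E) (α : ι → ℝ) (θ : E) (s t : ℝ) {p : E}
    (hp : p ∈ convexHull ℝ (range (shadowVertex x α θ s))) :
    ∃ b : ℝ, p + b • θ ∈ convexHull ℝ (range (shadowVertex x α θ t)) := by
  rw [← image_univ, mem_convexHull_shadowVertex_image] at hp
  obtain ⟨a, ha⟩ := hp
  refine ⟨t * a - s * a, ?_⟩
  rw [← image_univ, mem_convexHull_shadowVertex_image]
  refine ⟨a, ?_⟩
  convert ha using 2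
  module

section
variable {E ι : Type*} [AddCommGroup E] [Module ℝ E] [TopologicalSpace E]
  [IsTopologicalAddGroup E] [ContinuousSMul ℝ E]

/-- The endpoints of the chord of `P t` along a line of direction `θ` move affinely in `t`. -/
theorem exists_endpoint_affine (x : ι → E) (α : ι → ℝ) (θ : E) {c : ℝ} (hc : 0 < c)
    (hfull : (interior (convexHull ℝ (range (shadowVertex x α θ 0)))).Nonempty)
    (hvert : ∀ t ∈ Icc (-c) c, ∀ i, shadowVertex x α θ t i ∈
      extremePoints ℝ (convexHull ℝ (range (shadowVertex x α θ t))))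
    (hinj : ∀ t ∈ Icc (-c) c, Function.Injective (shadowVertex x α θ t))
    (hfaces : ∀ t ∈ Icc (-c) c, ∀ S : Set ι,
      IsExtreme ℝ (convexHull ℝ (range (shadowVertex x α θ 0)))
        (convexHull ℝ (shadowVertex x α θ 0 '' S)) →
      IsExtreme ℝ (convexHull ℝ (range (shadowVertex x α θ t)))
        (convexHull ℝ (shadowVertex x α θ t '' S)))
    {z : E} (hz : ∀ t, ∀ p ∈ convexHull ℝ (range (shadowVertex x α θ t)),
      ∃ ε > (0 : ℝ), ∃ s : ℝ, z + ε • (z - p) + s • θ ∈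
        convexHull ℝ (range (shadowVertex x α θ t)))
    {u v : ℝ → ℝ} (huv : ∀ t, u t ≤ v t)
    (hD : ∀ t r : ℝ, z + r • θ ∈ convexHull ℝ (range (shadowVertex x α θ t)) ↔
      r ∈ Icc (u t) (v t))
    {r₀ : ℝ} (hr₀ : r₀ = u 0 ∨ r₀ = v 0) :
    ∃ a : ℝ, (r₀ = u 0 → ∀ t ∈ Icc (-c) c, u t = r₀ + a * t) ∧
      (r₀ = v 0 → ∀ t ∈ Icc (-c) c, v t = r₀ + a * t) := by
  have h0c : (0 : ℝ) ∈ Icc (-c) c := ⟨by linarith, hc.le⟩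
  have hr₀mem : z + r₀ • θ ∈ convexHull ℝ (range (shadowVertex x α θ 0)) := by
    rw [hD]
    rcases hr₀ with rfl | rfl
    · exact left_mem_Icc.2 (huv 0)
    · exact right_mem_Icc.2 (huv 0)
  have hr₀int : z + r₀ • θ ∉ interior (convexHull ℝ (range (shadowVertex x α θ 0))) := by
    intro h
    have hcont : Continuous fun r : ℝ => z + r • θ := by fun_prop
    have hmem : r₀ ∈ interior (Icc (u 0) (v 0)) :=
      interior_maximal (fun r hr => (hD 0 r).1 (interior_subset hr))
        (isOpen_interior.preimage hcont) h
    rw [interior_Icc] at hmem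
    rcases hr₀ with rfl | rfl
    · exact hmem.1.false
    · exact hmem.2.false
  obtain ⟨S, hS, hSext, hSmem⟩ :=
    exists_isExtreme_convexHull_image_of_notMem_interior _ hfull hr₀mem hr₀int
  obtain ⟨a, ha⟩ := (mem_convexHull_shadowVertex_image ..).1 hSmem
  rw [zero_mul, zero_smul, sub_zero] at ha
  have hq : ∀ t : ℝ, z + (r₀ + a * t) • θ ∈ convexHull ℝ (shadowVertex x α θ t '' S) := by
    intro t
    refine (mem_convexHull_shadowVertex_image ..).2 ⟨a, ?_⟩
    convert ha using 2
    module
  have hmemIcc : ∀ t, r₀ + a * t ∈ Icc (u t) (v t) := fun t =>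
    (hD t _).1 (convexHull_mono (image_subset_range _ _) (hq t))
  have hnot : ∀ t ∈ Icc (-c) c, r₀ + a * t ∉ openSegment ℝ (u t) (v t) := by
    intro t ht hseg
    have hsub := (hfaces t ht S hSext).subset_of_mem_openSegment_line (convex_convexHull ℝ _)
      (convex_convexHull ℝ _) (hz t) (hD t) hseg (hq t)
    refine hS (eq_univ_of_forall fun i => ?_)
    have hi := hsub (subset_convexHull ℝ _ ⟨i, rfl⟩)
    have hext := extremePoints_convexHull_subset
      (inter_extremePoints_subset_extremePoints_of_subset (hfaces t ht S hSext).subset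
        ⟨hi, hvert t ht i⟩)
    obtain ⟨j, hj, hji⟩ := hext
    rwa [← hinj t ht hji]
  let M : Set (ℝ × ℝ) := {q | (z + q.1 • θ, q.2) ∈ convexHull ℝ (range fun i => (x i, α i))}
  have hM : ∀ t r, r ∈ Icc (u t) (v t) ↔ ∃ q ∈ M, q.1 + q.2 * t = r := by
    intro t r
    rw [← hD, ← image_univ, mem_convexHull_shadowVertex_image, image_univ]
    constructor
    · rintro ⟨b, hb⟩
      refine ⟨(r - t * b, b), ?_, by ring⟩
      change (z + (r - t * b) • θ, b) ∈ convexHull ℝ (range fun i => (x i, α i))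
      convert hb using 2
      module
    · rintro ⟨q, hq, rfl⟩
      refine ⟨q.2, ?_⟩
      convert (show (z + q.1 • θ, q.2) ∈ convexHull ℝ (range fun i => (x i, α i)) from hq)
        using 2
      module
  let T : Set ℝ := {t | ∀ q ∈ M, q.1 + q.2 * t ≤ r₀ + a * t}
  let B : Set ℝ := {t | ∀ q ∈ M, r₀ + a * t ≤ q.1 + q.2 * t}
  have hTcl : IsClosed T := by
    have h : T = ⋂ q ∈ M, {t | q.1 + q.2 * t ≤ r₀ + a * t} := by ext; simp [T]
    rw [h]
    exact isClosed_biInter fun q _ => isClosed_le (by fun_prop) (by fun_prop)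
  have hBcl : IsClosed B := by
    have h : B = ⋂ q ∈ M, {t | r₀ + a * t ≤ q.1 + q.2 * t} := by ext; simp [B]
    rw [h]
    exact isClosed_biInter fun q _ => isClosed_le (by fun_prop) (by fun_prop)
  have hT : ∀ t, t ∈ T ↔ v t = r₀ + a * t := by
    intro t
    constructor
    · intro h
      obtain ⟨q, hqM, hqt⟩ := (hM t _).1 (right_mem_Icc.2 (huv t))
      exact le_antisymm (hqt ▸ h q hqM) (hmemIcc t).2
    · intro h q hqM
      exact h ▸ ((hM t _).2 ⟨q, hqM, rfl⟩).2
  have hB : ∀ t, t ∈ B ↔ u t = r₀ + a * t := by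
    intro t
    constructor
    · intro h
      obtain ⟨q, hqM, hqt⟩ := (hM t _).1 (left_mem_Icc.2 (huv t))
      exact le_antisymm (hmemIcc t).1 (hqt ▸ h q hqM)
    · intro h q hqM
      exact h ▸ ((hM t _).2 ⟨q, hqM, rfl⟩).1
  have hcover : Icc (-c) c ⊆ T ∪ B := by
    intro t ht
    by_contra hcon
    simp only [mem_union, not_or, hT, hB] at hcon
    have h1 := lt_of_le_of_ne (hmemIcc t).1 hcon.2
    have h2 := lt_of_le_of_ne (hmemIcc t).2 (Ne.symm hcon.1)
    refine hnot t ht ?_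
    rw [openSegment_eq_Ioo (h1.trans h2)]
    exact ⟨h1, h2⟩
  have hdisj : ¬ (Icc (-c) c ∩ (T ∩ B)).Nonempty := by
    rintro ⟨t, ht, h1, h2⟩
    rw [hT] at h1
    rw [hB] at h2
    refine hnot t ht ?_
    rw [h1, h2, openSegment_same]
    rfl
  have hpre := isPreconnected_closed_iff.1 (isPreconnected_Icc (a := -c) (b := c)) T B hTcl hBcl
    hcover
  refine ⟨a, fun h t ht => ?_, fun h t ht => ?_⟩
  · refine (hB t).1 ((hcover ht).resolve_left fun hTt => hdisj (hpre ⟨t, ht, hTt⟩ ⟨0, h0c, ?_⟩))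
    rw [hB, h]; ring
  · refine (hT t).1 ((hcover ht).resolve_right fun hBt => hdisj (hpre ⟨0, h0c, ?_⟩ ⟨t, ht, hBt⟩))
    rw [hT, h]; ring

theorem volume_line_shadow [T2Space E] [Finite ι] (x : ι → E) (α : ι → ℝ) {θ : E} (hθ : θ ≠ 0)
    {c : ℝ} (hc : 0 < c)
    (hfull : (interior (convexHull ℝ (range (shadowVertex x α θ 0)))).Nonempty)
    (hvert : ∀ t ∈ Icc (-c) c, ∀ i, shadowVertex x α θ t i ∈
      extremePoints ℝ (convexHull ℝ (range (shadowVertex x α θ t))))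
    (hinj : ∀ t ∈ Icc (-c) c, Function.Injective (shadowVertex x α θ t))
    (hfaces : ∀ t ∈ Icc (-c) c, ∀ S : Set ι,
      IsExtreme ℝ (convexHull ℝ (range (shadowVertex x α θ 0)))
        (convexHull ℝ (shadowVertex x α θ 0 '' S)) →
      IsExtreme ℝ (convexHull ℝ (range (shadowVertex x α θ t)))
        (convexHull ℝ (shadowVertex x α θ t '' S)))
    {z : E} (hz : ∀ p ∈ convexHull ℝ (range (shadowVertex x α θ 0)),
      ∃ ε > (0 : ℝ), ∃ s : ℝ, z + ε • (z - p) + s • θ ∈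
        convexHull ℝ (range (shadowVertex x α θ 0))) {t : ℝ} (ht : t ∈ Icc (-c) c) :
    volume {r : ℝ | z + r • θ ∈ convexHull ℝ (range (shadowVertex x α θ t))} =
      ENNReal.ofReal ((c - t) / (2 * c)) *
        volume {r : ℝ | z + r • θ ∈ convexHull ℝ (range (shadowVertex x α θ (-c)))} +
      ENNReal.ofReal ((c + t) / (2 * c)) *
        volume {r : ℝ | z + r • θ ∈ convexHull ℝ (range (shadowVertex x α θ c))} := by
  have hne : ∃ r : ℝ, z + r • θ ∈ convexHull ℝ (range (shadowVertex x α θ 0)) := by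
    obtain ⟨p, hp⟩ := hfull
    have hp := interior_subset hp
    obtain ⟨ε, hε, s, hs⟩ := hz p hp
    refine ⟨s / (1 + ε), ?_⟩
    have h1 : (0 : ℝ) < 1 + ε := by linarith
    have hcomb : (ε / (1 + ε)) • p + (1 / (1 + ε)) • (z + ε • (z - p) + s • θ) =
        z + (s / (1 + ε)) • θ := by
      match_scalars <;> field_simp
      ring
    rw [← hcomb]
    exact convex_convexHull ℝ _ hp hs (by positivity) (by positivity) (by field_simp; ring)
  have hne' : ∀ s, ∃ r : ℝ, z + r • θ ∈ convexHull ℝ (range (shadowVertex x α θ s)) := by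
    intro s
    obtain ⟨r, hr⟩ := hne
    obtain ⟨b, hb⟩ := exists_shift_mem_convexHull_shadowVertex x α θ 0 s hr
    exact ⟨r + b, by rwa [add_smul, ← add_assoc]⟩
  have hz' : ∀ s, ∀ p ∈ convexHull ℝ (range (shadowVertex x α θ s)),
      ∃ ε > (0 : ℝ), ∃ r : ℝ, z + ε • (z - p) + r • θ ∈
        convexHull ℝ (range (shadowVertex x α θ s)) := by
    intro s p hp
    obtain ⟨b, hb⟩ := exists_shift_mem_convexHull_shadowVertex x α θ s 0 hp
    obtain ⟨ε, hε, r, hr⟩ := hz _ hb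
    obtain ⟨d, hd⟩ := exists_shift_mem_convexHull_shadowVertex x α θ 0 s hr
    refine ⟨ε, hε, r + d - ε * b, ?_⟩
    convert hd using 1
    module
  choose u v huv hD using fun s => exists_line_mem_iff_mem_Icc
    (convex_convexHull ℝ (range (shadowVertex x α θ s)))
    ((finite_range _).isCompact_convexHull ℝ) hθ (hne' s)
  have hvol : ∀ s, volume {r : ℝ | z + r • θ ∈ convexHull ℝ (range (shadowVertex x α θ s))} =
      ENNReal.ofReal (v s - u s) := by
    intro s
    rw [← Real.volume_Icc]
    exact congrArg volume (Set.ext (hD s))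
  obtain ⟨a, ha, -⟩ := exists_endpoint_affine x α θ hc hfull hvert hinj hfaces hz' huv hD
    (Or.inl rfl)
  obtain ⟨b, -, hb⟩ := exists_endpoint_affine x α θ hc hfull hvert hinj hfaces hz' huv hD
    (Or.inr rfl)
  have ha := ha rfl
  have hb := hb rfl
  have hcl : -c ∈ Icc (-c) c := left_mem_Icc.2 (by linarith)
  have hcr : c ∈ Icc (-c) c := right_mem_Icc.2 (by linarith)
  have h1 : 0 ≤ (c - t) / (2 * c) := div_nonneg (by linarith [ht.2]) (by linarith)
  have h2 : 0 ≤ (c + t) / (2 * c) := div_nonneg (by linarith [ht.1]) (by linarith)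
  rw [hvol, hvol, hvol, ← ENNReal.ofReal_mul h1, ← ENNReal.ofReal_mul h2,
    ← ENNReal.ofReal_add (mul_nonneg h1 (sub_nonneg.2 (huv _)))
      (mul_nonneg h2 (sub_nonneg.2 (huv _))), ha t ht, hb t ht, ha _ hcl, hb _ hcl, ha _ hcr,
    hb _ hcr]
  congr 1
  field_simp
  ring

end

theorem volume_shadow_eq {E ι : Type*} [NormedAddCommGroup E] [NormedSpace ℝ E]
    [FiniteDimensional ℝ E] [MeasurableSpace E] [BorelSpace E] (μ : Measure E)
    [μ.IsAddHaarMeasure] [Finite ι] (x : ι → E) (α : ι → ℝ) {θ : E} (hθ : θ ≠ 0)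
    {c : ℝ} (hc : 0 < c)
    (hfull : (interior (convexHull ℝ (range (shadowVertex x α θ 0)))).Nonempty)
    (hvert : ∀ t ∈ Icc (-c) c, ∀ i, shadowVertex x α θ t i ∈
      extremePoints ℝ (convexHull ℝ (range (shadowVertex x α θ t))))
    (hinj : ∀ t ∈ Icc (-c) c, Function.Injective (shadowVertex x α θ t))
    (hfaces : ∀ t ∈ Icc (-c) c, ∀ S : Set ι,
      IsExtreme ℝ (convexHull ℝ (range (shadowVertex x α θ 0)))
        (convexHull ℝ (shadowVertex x α θ 0 '' S)) →
      IsExtreme ℝ (convexHull ℝ (range (shadowVertex x α θ t)))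
        (convexHull ℝ (shadowVertex x α θ t '' S))) {t : ℝ} (ht : t ∈ Icc (-c) c) :
    μ (convexHull ℝ (range (shadowVertex x α θ t))) =
      ENNReal.ofReal ((c - t) / (2 * c)) * μ (convexHull ℝ (range (shadowVertex x α θ (-c)))) +
      ENNReal.ofReal ((c + t) / (2 * c)) * μ (convexHull ℝ (range (shadowVertex x α θ c))) := by
  obtain ⟨W, hW⟩ := Submodule.exists_isCompl (ℝ ∙ θ)
  let L : (W × ℝ) ≃L[ℝ] E := (((LinearEquiv.refl ℝ W).prodCongr
    (LinearEquiv.toSpanNonzeroSingleton ℝ E θ hθ)).trans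
      (Submodule.prodEquivOfIsCompl W (ℝ ∙ θ) hW.symm)).toContinuousLinearEquiv
  have hL : ∀ w r, L (w, r) = (w : E) + r • θ := fun w r => rfl
  let ν : Measure W := Measure.addHaar
  have hHaar : (μ.map L.symm).IsAddHaarMeasure := L.symm.isAddHaarMeasure_map μ
  obtain ⟨k, hk⟩ : ∃ k : ENNReal, μ.map L.symm = k • ν.prod (volume : Measure ℝ) :=
    ⟨_, Measure.isAddLeftInvariant_eq_smul _ _⟩
  have hmeas : ∀ s, MeasurableSet (convexHull ℝ (range (shadowVertex x α θ s))) := fun s =>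
    ((finite_range _).isCompact_convexHull ℝ).isClosed.measurableSet
  have hmeas' : ∀ s, MeasurableSet (L ⁻¹' convexHull ℝ (range (shadowVertex x α θ s))) :=
    fun s => L.continuous.measurable (hmeas s)
  have hfub : ∀ s, μ (convexHull ℝ (range (shadowVertex x α θ s))) =
      k * ∫⁻ w, volume {r : ℝ | (w : E) + r • θ ∈
        convexHull ℝ (range (shadowVertex x α θ s))} ∂ν := by
    intro s
    have h1 : μ (convexHull ℝ (range (shadowVertex x α θ s))) =
        μ.map L.symm (L ⁻¹' convexHull ℝ (range (shadowVertex x α θ s))) := by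
      rw [Measure.map_apply L.symm.continuous.measurable (hmeas' s), ← preimage_comp]
      simp
    rw [h1, hk, Measure.smul_apply, Measure.prod_apply (hmeas' s), smul_eq_mul]
    rfl
  have hmeasD : ∀ s, Measurable fun w : W => volume {r : ℝ | (w : E) + r • θ ∈
      convexHull ℝ (range (shadowVertex x α θ s))} := fun s =>
    measurable_measure_prodMk_left (hmeas' s)
  let K : Set W := (fun p => (L.symm p).1) '' convexHull ℝ (range (shadowVertex x α θ 0))
  have hK : Convex ℝ K := (convex_convexHull ℝ _).linear_image
    ((LinearMap.fst ℝ W ℝ).comp L.symm.toLinearEquiv.toLinearMap)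
  have hKmem : ∀ (w : W) s, ∀ r : ℝ, (w : E) + r • θ ∈
      convexHull ℝ (range (shadowVertex x α θ s)) → w ∈ K := by
    intro w s r h
    obtain ⟨b, hb⟩ := exists_shift_mem_convexHull_shadowVertex x α θ s 0 h
    refine ⟨_, hb, ?_⟩
    rw [add_assoc, ← add_smul, ← hL]
    simp
  have hae : ∀ᵐ w ∂ν, w ∉ frontier K := measure_eq_zero_iff_ae_notMem.1 (hK.addHaar_frontier ν)
  rw [hfub, hfub, hfub, mul_left_comm, mul_left_comm (ENNReal.ofReal _) k, ← mul_add,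
    ← lintegral_const_mul (ENNReal.ofReal ((c - t) / (2 * c))) (hmeasD _),
    ← lintegral_const_mul (ENNReal.ofReal ((c + t) / (2 * c))) (hmeasD _),
    ← lintegral_add_left ((hmeasD _).const_mul _)]
  congr 1
  refine lintegral_congr_ae ?_
  filter_upwards [hae] with w hw
  by_cases hwK : w ∈ K
  · have hwi : w ∈ interior K := by
      by_contra h
      exact hw ⟨subset_closure hwK, h⟩
    refine volume_line_shadow x α hθ hc hfull hvert hinj hfaces (fun p hp => ?_) ht
    obtain ⟨⟨w', r'⟩, rfl⟩ := L.surjective p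
    have hcont : Continuous fun ε : ℝ => w + ε • (w - w') := by fun_prop
    have hev : ∀ᶠ ε in 𝓝 (0 : ℝ), w + ε • (w - w') ∈ interior K :=
      hcont.continuousAt.eventually (isOpen_interior.mem_nhds (by simpa using hwi))
    obtain ⟨ε, hεK, hε⟩ :=
      ((hev.filter_mono nhdsWithin_le_nhds).and (self_mem_nhdsWithin (s := Ioi 0))).exists
    obtain ⟨q, hq, hqw⟩ := interior_subset hεK
    obtain ⟨⟨y, r⟩, rfl⟩ := L.surjective q
    simp only [ContinuousLinearEquiv.symm_apply_apply] at hqw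
    refine ⟨ε, hε, r + ε * r', ?_⟩
    convert hq using 1
    rw [hL, hL, hqw]
    push_cast
    module
  · have h0 : ∀ s, {r : ℝ | (w : E) + r • θ ∈
        convexHull ℝ (range (shadowVertex x α θ s))} = ∅ := fun s =>
      eq_empty_of_forall_notMem fun r hr => hwK (hKmem w s r hr)
    simp [h0]

/-- if the shadow system `P_t = conv{x_i + t α_i θ}` preserves the face lattice of
`P` on `[−c,c]` (with the correspondence `x_i ↦ x_i(t)` on vertices, and faces spanned by
corresponding vertex sets), then `t ↦ vol(P_t)` is affine on `[−c,c]`. -/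
theorem volume_affine_of_face_lattice_preserved (V : ℕ) (x : Fin V → EuclideanSpace ℝ (Fin 3))
    (α : Fin V → ℝ) (θ : EuclideanSpace ℝ (Fin 3)) (hθ : ‖θ‖ = 1) (c : ℝ) (hc : 0 < c)
    (P : ℝ → Set (EuclideanSpace ℝ (Fin 3)))
    (hP : ∀ t, P t = convexHull ℝ (Set.range fun i => x i + t • α i • θ))
    (hvert0 : Set.extremePoints ℝ (P 0) = Set.range x)
    (hfull : (interior (P 0)).Nonempty)
    (hvert : ∀ t ∈ Set.Icc (-c) c,
      Set.extremePoints ℝ (P t) = Set.range fun i => x i + t • α i • θ)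
    (hinj : ∀ t ∈ Set.Icc (-c) c, Function.Injective fun i => x i + t • α i • θ)
    (hfaces : ∀ t ∈ Set.Icc (-c) c, ∀ S : Set (Fin V),
      IsExtreme ℝ (P 0) (convexHull ℝ (x '' S)) ↔
        IsExtreme ℝ (P t) (convexHull ℝ ((fun i => x i + t • α i • θ) '' S))) :
    ∃ A B : ℝ, ∀ t ∈ Set.Icc (-c) c,
      (MeasureTheory.volume (P t)).toReal = A + B * t := by
  have hrange : ∀ t, P t = convexHull ℝ (range (shadowVertex x α θ t)) := hP
  have h0 : shadowVertex x α θ 0 = x := by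
    funext i
    simp [shadowVertex]
  have hθ0 : θ ≠ 0 := by
    rintro rfl
    simp at hθ
  have hmain := fun t (ht : t ∈ Icc (-c) c) =>
    volume_shadow_eq volume x α hθ0 hc (hrange 0 ▸ hfull)
      (fun t ht i => by
        rw [← hrange, hvert t ht]
        exact ⟨i, rfl⟩)
      hinj
      (fun t ht S hS => by
        rw [← hrange] at hS ⊢
        exact (hfaces t ht S).1 (h0 ▸ hS)) ht
  simp only [← hrange] at hmain
  have hfin : ∀ t, volume (P t) ≠ ⊤ := fun t => by
    rw [hrange]
    exact ((finite_range _).isCompact_convexHull ℝ).measure_lt_top.ne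
  refine ⟨((volume (P (-c))).toReal + (volume (P c)).toReal) / 2,
    ((volume (P c)).toReal - (volume (P (-c))).toReal) / (2 * c), fun t ht => ?_⟩
  have h1 : 0 ≤ (c - t) / (2 * c) := div_nonneg (by linarith [ht.2]) (by linarith)
  have h2 : 0 ≤ (c + t) / (2 * c) := div_nonneg (by linarith [ht.1]) (by linarith)
  rw [hmain t ht, ENNReal.toReal_add (ENNReal.mul_ne_top ENNReal.ofReal_ne_top (hfin _))
    (ENNReal.mul_ne_top ENNReal.ofReal_ne_top (hfin _)), ENNReal.toReal_mul, ENNReal.toReal_mul,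
    ENNReal.toReal_ofReal h1, ENNReal.toReal_ofReal h2]
  field_simp
  ring
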